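/- The following three conditions are equivalent: (1) [m choose k]_Z = 0 for every 1 ≤ k ≤ m−1 and every Z ∈ {X,Y}; (2) [m−1 choose k]_Z = ∏_{i=1}^{k} [m−1]_{σ^{i−1}(Z)} for every 0 ≤ k ≤ m−1 and every Z ∈ {X,Y}; (3) ξ = 1 and [m−1 choose k]_Z = ∏_{i=1}^{k} [m−1]_{σ^{i−1}(Z)} for every 0 ≤ k ≤ (m−1)/2 and every Z ∈ {X,Y}, where ξ = [m−1]_X if m is even and ξ = 1 if m is odd. -/

import Mathlib

noncomputable section
namespace TCQ

/-- The polynomial ring `ℤ[X̃,Ỹ]` (`X̃` indexed by `true`, `Ỹ` by `false`). -/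
abbrev R₀ : Type := MvPolynomial Bool ℤ

/-- The generic two-colored quantum numbers `[n]_{X̃}, [n]_{Ỹ} ∈ ℤ[X̃,Ỹ]`
(color `true` = `X̃`, `false` = `Ỹ`). -/
def q : Bool → ℕ → R₀
  | _, 0 => 0
  | _, 1 => 1
  | c, (n + 2) => MvPolynomial.X c * q (!c) (n + 1) - q c n

/-- `binom` is the generic two-colored quantum binomial coefficient
`[m choose n]_Z = ([m]_Z [m−1]_Z ⋯ [m−n+1]_Z)/([n]_Z ⋯ [1]_Z) ∈ ℤ[X̃,Ỹ]`, i.e. it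
satisfies `[m choose n]_Z · ([n]_Z ⋯ [1]_Z) = [m]_Z ⋯ [m−n+1]_Z` for all `n ≤ m` (this
determines it uniquely, `ℤ[X̃,Ỹ]` being a domain and the quantum numbers nonzero). -/
def IsBinom (binom : Bool → ℕ → ℕ → R₀) : Prop :=
  ∀ (Z : Bool) (m n : ℕ), n ≤ m →
    binom Z m n * ∏ i ∈ Finset.range n, q Z (i + 1) = ∏ i ∈ Finset.range n, q Z (m - i)

variable {Coef : Type*} [CommRing Coef]

/-- The two-colored quantum numbers `[n]_X, [n]_Y ∈ Coef` attached to `X, Y ∈ Coef`: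
`[0]_Z = 0`, `[1]_Z = 1`, `[n+1]_Z = Z·[n]_{σ(Z)} − [n−1]_Z`
(color `true` = `X`, `false` = `Y`). -/
def qc (x y : Coef) : Bool → ℕ → Coef
  | _, 0 => 0
  | _, 1 => 1
  | c, (n + 2) => (if c then x else y) * qc x y (!c) (n + 1) - qc x y c n

/-- The ring homomorphism `ℤ[X̃,Ỹ] → Coef` sending `X̃ ↦ X`, `Ỹ ↦ Y`.  The two-colored
quantum binomial coefficient `[m choose n]_Z ∈ Coef` is the image of the generic one
under this map. -/
def toCoef (x y : Coef) : R₀ →+* Coef :=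
  MvPolynomial.eval₂Hom (Int.castRingHom Coef) (fun b => if b then x else y)

end TCQ
end

namespace TCQ

section Numbers

variable {A : Type*} [CommRing A] (x y : A)

lemma qc_zero (Z : Bool) : qc x y Z 0 = 0 := by simp [qc]

lemma qc_one (Z : Bool) : qc x y Z 1 = 1 := by simp [qc]

lemma qc_add_two (Z : Bool) (n : ℕ) :
    qc x y Z (n + 2) = (if Z then x else y) * qc x y (!Z) (n + 1) - qc x y Z n := by
  simp [qc]

lemma iterate_not (n : ℕ) (Z : Bool) : Bool.not^[n] Z = if Even n then Z else !Z := by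
  induction n with
  | zero => simp
  | succ n ih =>
    rw [Function.iterate_succ_apply', ih]
    by_cases h : Even n <;> simp [h, Nat.even_add_one]

lemma qc_factor (n : ℕ) :
    (∃ s, ∀ Z, qc x y Z (2 * n) = (if Z then x else y) * s) ∧
      ∃ t, ∀ Z, qc x y Z (2 * n + 1) = t := by
  induction n with
  | zero => exact ⟨⟨0, by simp [qc_zero]⟩, ⟨1, by simp [qc_one]⟩⟩
  | succ n ih =>
    obtain ⟨⟨s, hs⟩, ⟨t, ht⟩⟩ := ih
    have h2 : ∀ Z, qc x y Z (2 * (n + 1)) = (if Z then x else y) * (t - s) := fun Z => by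
      rw [show 2 * (n + 1) = 2 * n + 2 by ring, qc_add_two, ht, hs]; ring
    refine ⟨⟨_, h2⟩, ⟨x * y * (t - s) - t, fun Z => ?_⟩⟩
    rw [show 2 * (n + 1) + 1 = (2 * n + 1) + 2 by ring, qc_add_two, ht,
      show 2 * n + 1 + 1 = 2 * (n + 1) by ring, h2]
    cases Z <;> simp <;> ring

lemma qc_not_of_odd {n : ℕ} (hn : ¬ Even n) (Z : Bool) : qc x y (!Z) n = qc x y Z n := by
  obtain ⟨k, rfl⟩ := Nat.not_even_iff_odd.mp hn
  obtain ⟨t, ht⟩ := (qc_factor x y k).2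
  rw [ht, ht]

lemma qc_mul_qc_not_of_even {n k : ℕ} (hn : Even n) (hk : Even k) (Z : Bool) :
    qc x y (!Z) n * qc x y Z k = qc x y Z n * qc x y (!Z) k := by
  obtain ⟨a, rfl⟩ := hn.exists_two_nsmul
  obtain ⟨b, rfl⟩ := hk.exists_two_nsmul
  obtain ⟨s, hs⟩ := (qc_factor x y a).1
  obtain ⟨t, ht⟩ := (qc_factor x y b).1
  simp only [smul_eq_mul, hs, ht]
  ring

lemma qc_add_add_one (a b : ℕ) (Z : Bool) :
    qc x y Z (a + b + 1) = qc x y Z (a + 1) * qc x y (Bool.not^[a] Z) (b + 1)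
      - qc x y Z a * qc x y (Bool.not^[a + 1] Z) b := by
  induction a using Nat.twoStepInduction generalizing Z with
  | zero => simp [qc_zero, qc_one]
  | one =>
    rw [show 1 + b + 1 = b + 2 by ring]
    simp [qc_add_two, qc_zero, qc_one]
  | more a h0 h1 =>
    rw [show a + 2 + b + 1 = (a + b + 1) + 2 by ring, qc_add_two, h0,
      show a + b + 1 + 1 = (a + 1) + b + 1 by ring, h1, qc_add_two x y Z (a + 1),
      qc_add_two x y Z a]
    simp only [Function.iterate_succ_apply, Bool.not_not]
    ring

/-- Consecutive two-colored quantum numbers never vanish simultaneously. -/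
lemma qc_succ_ne_zero [Nontrivial A] {n : ℕ} {Z W : Bool} (h : qc x y Z n = 0) :
    qc x y W (n + 1) ≠ 0 := by
  have key : ∀ n Z, qc x y Z n = 0 → qc x y (!Z) (n + 1) ≠ 0 := by
    intro n
    induction n with
    | zero => simp [qc_one]
    | succ n ih =>
      intro Z h h'
      rw [qc_add_two, Bool.not_not, h, mul_zero, zero_sub, neg_eq_zero] at h'
      exact ih _ h' (by rwa [Bool.not_not])
  by_cases hW : W = !Z
  · exact hW ▸ key n Z h
  · obtain rfl : W = Z := by cases W <;> cases Z <;> simp_all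
    by_cases hn : Even n
    · rw [← qc_not_of_odd x y (by simpa [Nat.even_add_one] using hn)]
      exact key n W h
    · rw [← qc_not_of_odd x y hn] at h
      simpa using key n _ h

lemma qc_of_add_eq {m : ℕ} (hm : ∀ Z, qc x y Z (m + 1) = 0) (j l : ℕ) (hjl : j + l = m)
    (Z : Bool) : qc x y Z l = qc x y Z (j + 1) * qc x y (Bool.not^[j] Z) m := by
  induction j using Nat.twoStepInduction generalizing Z l with
  | zero => obtain rfl : l = m := by omega
            simp [qc_one]
  | one =>
    obtain rfl : m = l + 1 := by omega
    have := hm Z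
    rw [qc_add_two] at this
    rw [show qc x y Z (1 + 1) = if Z then x else y by simp [qc_add_two, qc_one, qc_zero],
      Function.iterate_one]
    linear_combination -this
  | more j h0 h1 =>
    have e := qc_add_two x y Z l
    rw [h0 (l + 2) (by omega), h1 (l + 1) (by omega)] at e
    rw [qc_add_two x y Z (j + 1)]
    simp only [Function.iterate_succ_apply, Bool.not_not] at e ⊢
    linear_combination e

end Numbers

lemma q_eq_qc (Z : Bool) (n : ℕ) :
    q Z n = qc (MvPolynomial.X true : R₀) (MvPolynomial.X false) Z n := by
  induction n using Nat.twoStepInduction generalizing Z with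
  | zero => simp [q, qc]
  | one => simp [q, qc]
  | more n h0 h1 => cases Z <;> simp [q, qc, h0, h1]

lemma toCoef_q {A : Type*} [CommRing A] (x y : A) (Z : Bool) (n : ℕ) :
    toCoef x y (q Z n) = qc x y Z n := by
  induction n using Nat.twoStepInduction generalizing Z with
  | zero => simp [q, qc]
  | one => simp [q, qc]
  | more n h0 h1 => simp only [q, qc, map_sub, map_mul, h0, h1]; simp [toCoef]

lemma q_succ_ne_zero (Z : Bool) (n : ℕ) : q Z (n + 1) ≠ 0 := by
  have key : ∀ n Z, qc (2 : ℤ) 2 Z n = n := fun n => by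
    induction n using Nat.twoStepInduction with
    | zero => simp [qc]
    | one => simp [qc]
    | more n h0 h1 => intro Z; rw [qc_add_two, h0, h1]; push_cast; split_ifs <;> ring
  intro h
  have := toCoef_q (2 : ℤ) 2 Z (n + 1)
  rw [h, map_zero, key] at this
  norm_cast at this

lemma IsBinom.mul_prod_mul_prod {B : Bool → ℕ → ℕ → R₀} (hB : IsBinom B) (Z : Bool) (a b : ℕ) :
    B Z (a + b) a * (∏ i ∈ Finset.range a, q Z (i + 1)) * ∏ i ∈ Finset.range b, q Z (i + 1) =
      ∏ i ∈ Finset.range (a + b), q Z (i + 1) := by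
  rw [hB Z (a + b) a (by omega)]
  induction a with
  | zero => simp
  | succ a ih =>
    rw [Finset.prod_range_succ', show a + 1 + b = a + b + 1 by ring, Finset.prod_range_succ, ← ih]
    simp only [Nat.add_sub_add_right, Nat.sub_zero]
    ring

lemma prod_q_ne_zero (Z : Bool) (a : ℕ) : ∏ i ∈ Finset.range a, q Z (i + 1) ≠ 0 :=
  Finset.prod_ne_zero_iff.mpr fun _ _ => q_succ_ne_zero _ _

lemma IsBinom.symm {B : Bool → ℕ → ℕ → R₀} (hB : IsBinom B) (Z : Bool) (a b : ℕ) :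
    B Z (a + b) a = B Z (a + b) b := by
  have h := hB.mul_prod_mul_prod Z b a
  rw [add_comm b a, ← hB.mul_prod_mul_prod Z a b, mul_right_comm] at h
  exact (mul_right_cancel₀ (prod_q_ne_zero Z a) (mul_right_cancel₀ (prod_q_ne_zero Z b) h)).symm

lemma IsBinom.zero_right {B : Bool → ℕ → ℕ → R₀} (hB : IsBinom B) (Z : Bool) (m : ℕ) :
    B Z m 0 = 1 := by
  simpa using hB Z m 0 (by omega)

lemma IsBinom.q_mul_succ_right {B : Bool → ℕ → ℕ → R₀} (hB : IsBinom B) (Z : Bool) (a b : ℕ) :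
    q Z (a + 1) * B Z (a + b + 1) (a + 1) = q Z (b + 1) * B Z (a + b + 1) a := by
  have h := hB.mul_prod_mul_prod Z (a + 1) b
  have h' := hB.mul_prod_mul_prod Z a (b + 1)
  rw [show a + 1 + b = a + b + 1 by ring, Finset.prod_range_succ _ a] at h
  rw [← add_assoc, ← h, Finset.prod_range_succ _ b] at h'
  refine mul_right_cancel₀ (prod_q_ne_zero Z a) (mul_right_cancel₀ (prod_q_ne_zero Z b) ?_)
  linear_combination -h'

lemma IsBinom.q_mul_succ_left {B : Bool → ℕ → ℕ → R₀} (hB : IsBinom B) (Z : Bool) (a b : ℕ) :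
    q Z (b + 1) * B Z (a + b + 1) a = q Z (a + b + 1) * B Z (a + b) a := by
  have h := hB.mul_prod_mul_prod Z a b
  have h' := hB.mul_prod_mul_prod Z a (b + 1)
  rw [← add_assoc, Finset.prod_range_succ _ (a + b), ← h, Finset.prod_range_succ _ b] at h'
  refine mul_right_cancel₀ (prod_q_ne_zero Z a) (mul_right_cancel₀ (prod_q_ne_zero Z b) ?_)
  linear_combination h'

lemma IsBinom.pascal {B : Bool → ℕ → ℕ → R₀} (hB : IsBinom B) (Z : Bool) (j l : ℕ) :
    B Z (j + l + 2) (j + 1) = q (Bool.not^[j + l] Z) (j + 2) * B Z (j + l + 1) (j + 1)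
      - q (Bool.not^[j] Z) l * B Z (j + l + 1) j := by
  have h1 := hB.q_mul_succ_left Z (j + 1) l
  have h2 := hB.q_mul_succ_right Z j l
  rw [show j + 1 + l + 1 = j + l + 2 by ring, show j + 1 + l = j + l + 1 by ring] at h1
  have h3 : q Z (j + l + 2) = q Z (j + 2) * q (Bool.not^[j + 1] Z) (l + 1)
      - q Z (j + 1) * q (Bool.not^[j + 2] Z) l := by
    have := qc_add_add_one (MvPolynomial.X true : R₀) (MvPolynomial.X false) (j + 1) l Z
    simp only [q_eq_qc]
    rw [← this]
    congr 1
    ring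
  have h4 : q Z (j + 2) * q (Bool.not^[j + 1] Z) (l + 1)
      = q (Bool.not^[j + l] Z) (j + 2) * q Z (l + 1) := by
    simp only [iterate_not, q_eq_qc]
    by_cases hj : Even j <;> by_cases hl : Even l <;>
      simp only [hj, hl, Nat.even_add, Nat.even_add_one, not_true, not_false_iff, if_true, if_false,
        iff_true, iff_false]
    · rw [qc_not_of_odd _ _ (by simpa [Nat.even_add_one] using hl)]
    · rw [qc_mul_qc_not_of_even _ _ (by simpa [Nat.even_add_one] using hj)
        (by simpa [Nat.even_add_one] using hl)]
    · rw [qc_not_of_odd _ _ (n := j + 2) (by simpa [Nat.even_add_one] using hj)]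
  simp only [Function.iterate_succ_apply, Bool.not_not] at h3 h4
  refine mul_left_cancel₀ (q_succ_ne_zero Z l) ?_
  linear_combination h1 + B Z (j + l + 1) (j + 1) * (h3 + h4) - q (Bool.not^[j] Z) l * h2

section Specialization

variable {A : Type*} [CommRing A] (x y : A) {B : Bool → ℕ → ℕ → R₀}

lemma q_succ_mul_sub (hB : IsBinom B) {j l : ℕ} (hm : ∀ Z, qc x y Z (j + l + 2) = 0) (Z : Bool) :
    qc x y Z (j + 1) * (toCoef x y (B Z (j + l + 1) (j + 1))
      - qc x y (Bool.not^[j] Z) (j + l + 1) * toCoef x y (B Z (j + l + 1) j)) = 0 := by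
  have h := congrArg (toCoef x y) (hB.q_mul_succ_right Z j l)
  simp only [map_mul, toCoef_q] at h
  rw [qc_of_add_eq x y hm j (l + 1) (by ring) Z] at h
  linear_combination h

lemma toCoef_binom_eq (hB : IsBinom B) {j l : ℕ} (hm : ∀ Z, qc x y Z (j + l + 2) = 0) (Z : Bool) :
    toCoef x y (B Z (j + l + 2) (j + 1)) = qc x y (Bool.not^[j + l] Z) (j + 2) *
      (toCoef x y (B Z (j + l + 1) (j + 1))
        - qc x y (Bool.not^[j] Z) (j + l + 1) * toCoef x y (B Z (j + l + 1) j)) := by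
  have h := congrArg (toCoef x y) (hB.pascal Z j l)
  simp only [map_mul, map_sub, toCoef_q] at h
  have h' := qc_of_add_eq x y hm (j + 1) l (by ring) (Bool.not^[j] Z)
  have e : qc x y (Bool.not^[j] Z) (j + 2) * qc x y (Bool.not^[j + 1] (Bool.not^[j] Z)) (j + l + 1)
      = qc x y (Bool.not^[j + l] Z) (j + 2) * qc x y (Bool.not^[j] Z) (j + l + 1) := by
    simp only [iterate_not]
    by_cases hj : Even j <;> by_cases hl : Even l <;>
      simp only [hj, hl, Nat.even_add, Nat.even_add_one, not_true, not_false_iff, if_true, if_false,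
        iff_true, iff_false, Bool.not_not]
    · rw [qc_not_of_odd _ _ (n := j + l + 1) (by simp [Nat.even_add, Nat.even_add_one, hj, hl])]
    · rw [qc_mul_qc_not_of_even _ _ (n := j + 2)
        (by simpa [Nat.even_add_one] using hj) (by simp [Nat.even_add, Nat.even_add_one, hj, hl])]
    · rw [qc_not_of_odd _ _ (n := j + 2) (by simpa [Nat.even_add_one] using hj)]
  rw [h, h']
  linear_combination -(toCoef x y (B Z (j + l + 1) j)) * e

lemma toCoef_binom_eq_zero_iff [IsDomain A] (hB : IsBinom B) {j l : ℕ}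
    (hm : ∀ Z, qc x y Z (j + l + 2) = 0) (Z : Bool) :
    toCoef x y (B Z (j + l + 2) (j + 1)) = 0 ↔ toCoef x y (B Z (j + l + 1) (j + 1))
      = qc x y (Bool.not^[j] Z) (j + l + 1) * toCoef x y (B Z (j + l + 1) j) := by
  rw [toCoef_binom_eq x y hB hm, ← sub_eq_zero (b := _ * _)]
  constructor
  · intro h
    rcases mul_eq_zero.mp (q_succ_mul_sub x y hB hm Z) with h0 | h0
    · exact (mul_eq_zero.mp h).resolve_left (qc_succ_ne_zero x y h0)
    · exact h0
  · intro h
    rw [h, mul_zero]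

lemma toCoef_binom_eq_zero_of_le_iff [IsDomain A] (hB : IsBinom B) {n : ℕ}
    (hm : ∀ Z, qc x y Z (n + 1) = 0) {K : ℕ} (hK : K ≤ n) (Z : Bool) :
    (∀ k, 1 ≤ k → k ≤ K → toCoef x y (B Z (n + 1) k) = 0) ↔
      ∀ k ≤ K, toCoef x y (B Z n k) = ∏ i ∈ Finset.range k, qc x y (Bool.not^[i] Z) n := by
  have step : ∀ k < n, toCoef x y (B Z (n + 1) (k + 1)) = 0 ↔
      toCoef x y (B Z n (k + 1)) = qc x y (Bool.not^[k] Z) n * toCoef x y (B Z n k) := by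
    intro k hk
    obtain ⟨l, rfl⟩ := Nat.exists_eq_add_of_lt hk
    exact toCoef_binom_eq_zero_iff x y hB hm Z
  constructor
  · intro h k
    induction k with
    | zero => simp [hB.zero_right]
    | succ k ih =>
      intro hk
      rw [(step k (by omega)).mp (h _ (by omega) hk), ih (by omega), Finset.prod_range_succ,
        mul_comm]
  · intro h k hk1 hk
    obtain ⟨k, rfl⟩ := Nat.exists_eq_add_of_le' hk1
    rw [step k (by omega), h _ hk, h k (by omega), Finset.prod_range_succ, mul_comm]

lemma qc_eq_one_of_binom (hB : IsBinom B) {n : ℕ} (hm : ∀ Z, qc x y Z (n + 1) = 0)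
    (hn : ¬ Even n) {Z : Bool}
    (h : toCoef x y (B Z n n) = ∏ i ∈ Finset.range n, qc x y (Bool.not^[i] Z) n) :
    qc x y Z n = 1 := by
  have hc : ∀ i, qc x y (Bool.not^[i] Z) n = qc x y Z n := fun i => by
    rw [iterate_not]
    split_ifs
    · rfl
    · exact qc_not_of_odd x y hn Z
  obtain ⟨a, rfl⟩ := Nat.not_even_iff_odd.mp hn
  have hsq := qc_of_add_eq x y hm (2 * a) 1 rfl Z
  have hs := hB.symm Z (2 * a + 1) 0
  rw [add_zero, hB.zero_right] at hs
  simp only [hc, qc_one, hs, map_one, Finset.prod_const, Finset.card_range] at h hsq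
  rw [pow_succ, pow_mul, sq, ← hsq, one_pow, one_mul] at h
  exact h.symm

end Specialization

end TCQ


open TCQ in
/-- let `Coef` be an integral domain, `X, Y ∈ Coef`, `m ≥ 2`, and assume
`[m]_X = [m]_Y = 0`.  The following are equivalent:
(1) `[m choose k]_Z = 0` for all `1 ≤ k ≤ m−1` and `Z ∈ {X,Y}`;
(2) `[m−1 choose k]_Z = ∏_{i=1}^{k} [m−1]_{σ^{i−1}(Z)}` for all `0 ≤ k ≤ m−1`, `Z ∈ {X,Y}`;
(3) `ξ = 1` and `[m−1 choose k]_Z = ∏_{i=1}^{k} [m−1]_{σ^{i−1}(Z)}` for all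
`0 ≤ k ≤ (m−1)/2`, `Z ∈ {X,Y}`, where `ξ = [m−1]_X` if `m` is even and `ξ = 1` if `m`
is odd. -/
theorem tcq_equivalent_assumptions {Coef : Type*} [CommRing Coef] [IsDomain Coef]
    (x y : Coef) (m : ℕ) (hm : 2 ≤ m)
    (hmx : qc x y true m = 0) (hmy : qc x y false m = 0)
    (gbinom : Bool → ℕ → ℕ → TCQ.R₀) (hgbinom : IsBinom gbinom) :
    ((∀ k, 1 ≤ k → k ≤ m - 1 → ∀ Z : Bool, toCoef x y (gbinom Z m k) = 0)
      ↔ (∀ k ≤ m - 1, ∀ Z : Bool,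
          toCoef x y (gbinom Z (m - 1) k)
            = ∏ i ∈ Finset.range k, qc x y (Bool.not^[i] Z) (m - 1)))
    ∧
    ((∀ k, 1 ≤ k → k ≤ m - 1 → ∀ Z : Bool, toCoef x y (gbinom Z m k) = 0)
      ↔ ((if Even m then qc x y true (m - 1) else 1) = 1
          ∧ ∀ k ≤ (m - 1) / 2, ∀ Z : Bool,
              toCoef x y (gbinom Z (m - 1) k)
                = ∏ i ∈ Finset.range k, qc x y (Bool.not^[i] Z) (m - 1))) := by
  obtain ⟨n, rfl⟩ : ∃ n, m = n + 1 := ⟨m - 1, by omega⟩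
  simp only [Nat.add_sub_cancel]
  have h0 : ∀ Z, qc x y Z (n + 1) = 0 := by
    rintro (_ | _)
    · exact hmy
    · exact hmx
  have vanish : ∀ K ≤ n, (∀ k, 1 ≤ k → k ≤ K → ∀ Z, toCoef x y (gbinom Z (n + 1) k) = 0) ↔
      ∀ k ≤ K, ∀ Z, toCoef x y (gbinom Z n k)
        = ∏ i ∈ Finset.range k, qc x y (Bool.not^[i] Z) n := fun K hK =>
    ⟨fun h k hk Z => (toCoef_binom_eq_zero_of_le_iff x y hgbinom h0 hK Z).mp
        (fun k h1 hk => h k h1 hk Z) k hk,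
      fun h k h1 hk Z => (toCoef_binom_eq_zero_of_le_iff x y hgbinom h0 hK Z).mpr
        (fun k hk => h k hk Z) k h1 hk⟩
  refine ⟨vanish n le_rfl, ?_⟩
  constructor
  · intro h
    refine ⟨?_, (vanish (n / 2) (by omega)).mp fun k h1 hk => h k h1 (by omega)⟩
    split_ifs with hn
    · exact qc_eq_one_of_binom x y hgbinom h0 (by simpa [Nat.even_add_one] using hn)
        ((vanish n le_rfl).mp h n le_rfl true)
    · rfl
  · rintro ⟨hξ, h⟩ k h1 hk Z
    have low := (vanish (n / 2) (by omega)).mpr h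
    rcases le_or_gt k (n / 2) with hk2 | hk2
    · exact low k h1 hk2 Z
    obtain ⟨l, hl⟩ := Nat.exists_eq_add_of_le (show k ≤ n + 1 by omega)
    rcases le_or_gt l (n / 2) with hl2 | hl2
    · rw [hl, hgbinom.symm, ← hl]
      exact low l (by omega) hl2 Z
    -- the middle binomial coefficient, occurring only for even `m`
    obtain ⟨j, rfl⟩ := Nat.exists_eq_add_of_le' h1
    obtain rfl : l = j + 1 := by omega
    obtain rfl : n = j + j + 1 := by omega
    rw [if_pos ⟨j + 1, by ring⟩] at hξ
    have hc : ∀ W, qc x y W (j + j + 1) = 1 := by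
      rintro (_ | _)
      · rw [← hξ, ← qc_not_of_odd x y (by simp [Nat.even_add_one])]; rfl
      · exact hξ
    have hs := hgbinom.symm Z (j + 1) j
    rw [show j + 1 + j = j + j + 1 by ring] at hs
    rw [toCoef_binom_eq_zero_iff x y hgbinom h0, hc, one_mul, hs]
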